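/- arXiv:1310.4257 — 2 statements merged into one kernel-verified Lean document; each statement's English description precedes it below -/
import Mathlib

section
/- Let p be an odd prime, x ∈ ℤ_p, and n ≥ 0 an integer. Then the sequence N ↦ ∑_{a=0}^{p^N − 1} (−1)^a (x + a)^n converges in ℤ_p as N → ∞, and its limit equals E_n(x), the value at x of the n-th Euler polynomial (whose coefficients lie in ℤ[1/2] ⊆ ℤ_p). -/
/-- The Euler polynomials `E_n(x)`, defined (over `ℚ`) by the recurrence
`E_n(x) = x^n - (1/2) ∑_{k<n} (n choose k) E_k(x)` equivalent to the
generating function `2e^{xt}/(e^t + 1) = ∑_{n=0}^∞ E_n(x) t^n/n!`. -/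
noncomputable def eulerPoly : ℕ → Polynomial ℚ
  | n => Polynomial.X ^ n -
      Polynomial.C (1 / 2 : ℚ) * ∑ k : Fin n, (n.choose k : ℚ) • eulerPoly k
  decreasing_by exact k.isLt

theorem alternating_sum_pow_add_half_sum {K : Type*} [Field K] [CharZero K] (x : K) (n M : ℕ)
    (hM : Odd M) :
    ∑ a ∈ Finset.range M, (-1 : K) ^ a * (x + a) ^ n =
      (x ^ n + (x + M) ^ n) / 2 - 1 / 2 * ∑ k : Fin n, (n.choose k : K) *
        ∑ a ∈ Finset.range M, (-1 : K) ^ a * (x + a) ^ (k : ℕ) := by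
  have binomial_expansion : ∑ a ∈ Finset.range M, (-1 : K) ^ a * (x + a + 1) ^ n =
      ∑ k ∈ Finset.range (n + 1), (n.choose k : K) *
        ∑ a ∈ Finset.range M, (-1 : K) ^ a * (x + a) ^ k := by
    simp_rw [add_pow (x + _) 1 n, Finset.mul_sum]
    rw [Finset.sum_comm]
    refine Finset.sum_congr rfl fun k _ => Finset.sum_congr rfl fun a _ => ?_
    ring
  have shift : ∑ a ∈ Finset.range M, (-1 : K) ^ a * (x + a + 1) ^ n =
      -∑ a ∈ Finset.range M, (-1 : K) ^ a * (x + a) ^ n + x ^ n + (x + M) ^ n := by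
    have h := (Finset.sum_range_succ (fun a : ℕ => (-1 : K) ^ a * (x + a) ^ n) M).symm.trans
      (Finset.sum_range_succ' (fun a : ℕ => (-1 : K) ^ a * (x + a) ^ n) M)
    simp only [hM.neg_one_pow, pow_succ, Nat.cast_add, Nat.cast_one, Nat.cast_zero, add_zero,
      pow_zero, one_mul, mul_neg, mul_one, neg_mul, Finset.sum_neg_distrib, ← add_assoc] at h
    linear_combination h
  rw [binomial_expansion, Finset.sum_range_succ, Nat.choose_self, Nat.cast_one, one_mul,
    Finset.sum_range] at shift
  linear_combination shift / 2

theorem aeval_eulerPoly {K : Type*} [Field K] [Algebra ℚ K] (x : K) (n : ℕ) :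
    Polynomial.aeval x (eulerPoly n) =
      x ^ n - 1 / 2 * ∑ k : Fin n, (n.choose k : K) * Polynomial.aeval x (eulerPoly k) := by
  rw [eulerPoly]
  simp [map_sum, Algebra.smul_def]

theorem tendsto_alternating_sum_pow (p : ℕ) [Fact p.Prime] (hp : p ≠ 2) (x : ℚ_[p]) (n : ℕ) :
    Filter.Tendsto
      (fun N : ℕ => ∑ a ∈ Finset.range (p ^ N), (-1 : ℚ_[p]) ^ a * (x + a) ^ n)
      Filter.atTop (nhds (Polynomial.aeval x (eulerPoly n))) := by
  induction n using Nat.strong_induction_on with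
  | _ n ih =>
    have hodd (N : ℕ) : Odd (p ^ N) := ((Fact.out : p.Prime).odd_of_ne_two hp).pow
    simp_rw [fun N => alternating_sum_pow_add_half_sum x n (p ^ N) (hodd N), aeval_eulerPoly x n]
    refine Filter.Tendsto.sub ?_ (Filter.Tendsto.const_mul _ <|
      tendsto_finsetSum _ fun k _ => (ih k k.isLt).const_mul _)
    have hpow : Filter.Tendsto (fun N : ℕ => ((p ^ N : ℕ) : ℚ_[p])) Filter.atTop (nhds 0) := by
      simpa using tendsto_pow_atTop_nhds_zero_of_norm_lt_one (Padic.norm_p_lt_one (p := p))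
    have h := (((hpow.const_add x).pow n).const_add (x ^ n)).div_const 2
    rwa [add_zero, add_self_div_two] at h

/-- Let `p` be an odd prime, `x ∈ ℤ_p` and `n ≥ 0`. The
sequence `N ↦ ∑_{a=0}^{p^N − 1} (−1)^a (x + a)^n` converges in `ℤ_p` as
`N → ∞`, and its limit is `E_n(x)`, the value at `x` of the `n`-th Euler
polynomial (whose coefficients lie in `ℤ[1/2] ⊆ ℤ_p`; the element `E ∈ ℤ_p`
below is characterized by its image in `ℚ_p` being `E_n(x)`). -/
theorem statement10 (p : ℕ) [Fact p.Prime] (hp : p ≠ 2) (x : ℤ_[p]) (n : ℕ)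
    (E : ℤ_[p]) (hE : (E : ℚ_[p]) = Polynomial.aeval ((x : ℚ_[p])) (eulerPoly n)) :
    Filter.Tendsto
      (fun N : ℕ => ∑ a ∈ Finset.range (p ^ N), (-1 : ℤ_[p]) ^ a * (x + (a : ℤ_[p])) ^ n)
      Filter.atTop (nhds E) := by
  refine tendsto_subtype_rng.mpr ?_
  rw [hE]
  simpa using tendsto_alternating_sum_pow p hp (x : ℚ_[p]) n
end

section
/- Let p be an odd prime. There exist m ∈ ℚ, λ ∈ ℕ, c ∈ ℚ, and n_0 ∈ ℕ such that for all n ≥ n_0, ord_p( ∏_{t=n_0}^{n} ∏_{χ} E_{0,χ} ) = m·p^n + λ·n + c, where the inner product runs over all odd primitive Dirichlet characters χ of conductor p^t with values in ℂ_p and E_{0,χ} = ∑_{a=1}^{p^t} (−1)^a χ(a). -/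
open Finset

section
variable {p : ℕ} [Fact p.Prime]

lemma natCast_zmod_pow_eq_one_iff (n g k : ℕ) :
    ((g : ZMod n) ^ k = 1) ↔ (n : ℤ) ∣ (g : ℤ) ^ k - 1 := by
  rw [← ZMod.intCast_zmod_eq_zero_iff_dvd]
  push_cast
  rw [sub_eq_zero]

lemma exists_orderOf_natCast_zmod_prime_pow (hp2 : p ≠ 2) :
    ∃ g : ℕ, ∀ r : ℕ, orderOf (g : ZMod (p ^ (r + 1))) = (p - 1) * p ^ r := by
  have hp : p.Prime := Fact.out
  have hp1 : 1 < p := hp.one_lt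
  have : IsCyclic (ZMod (p ^ 2))ˣ := ZMod.isCyclic_units_of_prime_pow p hp hp2 2
  have : NeZero (p ^ 2) := ⟨pow_ne_zero _ hp.ne_zero⟩
  obtain ⟨u, hu⟩ := IsCyclic.exists_generator (α := (ZMod (p ^ 2))ˣ)
  have hcard : orderOf u = p * (p - 1) := by
    rw [orderOf_eq_card_of_forall_mem_zpowers hu, Nat.card_eq_fintype_card,
      ZMod.card_units_eq_totient,
      Nat.totient_prime_pow hp (by norm_num)]
    simp
  set g : ℕ := (u : ZMod (p ^ 2)).val with hgdef
  have hgu : (g : ZMod (p ^ 2)) = u := by simp [hgdef]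
  have hord2 : ∀ k : ℕ, ((p ^ 2 : ℕ) : ℤ) ∣ (g : ℤ) ^ k - 1 → p * (p - 1) ∣ k := by
    intro k hk
    rw [← natCast_zmod_pow_eq_one_iff, hgu] at hk
    rw [← hcard, ← orderOf_units]
    exact orderOf_dvd_of_pow_eq_one hk
  have hcop : g.Coprime p := by
    have := ZMod.val_coe_unit_coprime u
    exact Nat.Coprime.coprime_dvd_right (dvd_pow_self p (by norm_num)) this
  have hordp : ∀ k : ℕ, (p : ℤ) ∣ (g : ℤ) ^ k - 1 → p - 1 ∣ k := by
    intro k hk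
    have h : ((p ^ 2 : ℕ) : ℤ) ∣ (g : ℤ) ^ (k * p) - 1 := by
      have := dvd_sub_pow_of_dvd_sub (p := p) (R := ℤ) (a := (g : ℤ) ^ k) (b := 1)
        (by simpa using hk) 1
      simpa [pow_mul] using this
    have := hord2 _ h
    rw [mul_comm k] at this
    exact Nat.dvd_of_mul_dvd_mul_left hp.pos this
  have hferm : (p : ℤ) ∣ (g : ℤ) ^ (p - 1) - 1 := by
    rw [← natCast_zmod_pow_eq_one_iff]
    apply ZMod.pow_card_sub_one_eq_one
    rw [Ne, ZMod.natCast_eq_zero_iff]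
    exact fun h => (Nat.Prime.coprime_iff_not_dvd hp).1 hcop.symm h
  have hval : ∀ j : ℕ, emultiplicity (p : ℤ) ((g : ℤ) ^ ((p - 1) * p ^ j) - 1) = (1 + j : ℕ) := by
    intro j
    have h1 := Int.emultiplicity_pow_sub_pow hp (hp.odd_of_ne_two hp2)
      (x := (g : ℤ) ^ (p - 1)) (y := 1)
      hferm (by
        intro h
        have h2 := Nat.prime_iff_prime_int.1 hp |>.dvd_of_dvd_pow h
        exact (Nat.Prime.coprime_iff_not_dvd hp).1 hcop.symm (Int.natCast_dvd_natCast.1 h2)) (p ^ j)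
    rw [one_pow, ← pow_mul] at h1
    rw [h1, emultiplicity_pow_self_of_prime hp.prime]
    have h2 : emultiplicity (p : ℤ) ((g : ℤ) ^ (p - 1) - 1) = (1 : ℕ) := by
      rw [emultiplicity_eq_coe]
      refine ⟨by simpa using hferm, fun h => ?_⟩
      have := Nat.le_of_dvd (by omega) (hord2 (p - 1) (by simpa using h))
      nlinarith [Nat.sub_pos_of_lt hp1]
    rw [h2]
    push_cast
    rfl
  refine ⟨g, fun r => ?_⟩
  have hd1 : orderOf (g : ZMod (p ^ (r + 1))) ∣ (p - 1) * p ^ r := by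
    apply orderOf_dvd_of_pow_eq_one
    rw [natCast_zmod_pow_eq_one_iff]
    push_cast
    apply pow_dvd_of_le_emultiplicity
    rw [hval, add_comm]
  have hspec := (natCast_zmod_pow_eq_one_iff _ _ _).1 (pow_orderOf_eq_one (g : ZMod (p ^ (r + 1))))
  obtain ⟨d, hd⟩ := hordp _ (dvd_trans (by push_cast; exact dvd_pow_self _ (by omega)) hspec)
  rw [hd] at hd1
  obtain ⟨j, hj, rfl⟩ := (Nat.dvd_prime_pow hp).1 (Nat.dvd_of_mul_dvd_mul_left (by omega) hd1)
  rw [hd] at hspec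
  push_cast at hspec
  have h3 := le_emultiplicity_of_pow_dvd hspec
  rw [hval] at h3
  have h4 : r + 1 ≤ 1 + j := by exact_mod_cast h3
  have : j = r := by omega
  rw [hd, this]

lemma val_pow_injOn {n g : ℕ} [NeZero n] :
    Set.InjOn (fun l => ((g : ZMod n) ^ l).val) (Set.Iio (orderOf (g : ZMod n))) := by
  intro a ha b hb h
  exact pow_injOn_Iio_orderOf ha hb (ZMod.val_injective n h)

lemma coprime_of_orderOf {g r : ℕ}
    (hg : orderOf (g : ZMod (p ^ (r + 1))) = (p - 1) * p ^ r) : g.Coprime (p ^ (r + 1)) := by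
  have hp : p.Prime := Fact.out
  have hpos : 0 < orderOf (g : ZMod (p ^ (r + 1))) := by
    rw [hg]; exact Nat.mul_pos (Nat.sub_pos_of_lt hp.one_lt) (pow_pos hp.pos _)
  rw [← ZMod.isUnit_iff_coprime]
  exact (orderOf_pos_iff.1 hpos).isUnit

lemma sum_filter_not_dvd_eq_sum_val_pow {M : Type*} [AddCommMonoid M] {g r : ℕ}
    (hg : orderOf (g : ZMod (p ^ (r + 1))) = (p - 1) * p ^ r) (f : ℕ → M) :
    ∑ a ∈ (range (p ^ (r + 1))).filter (fun a => ¬ p ∣ a), f a =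
      ∑ l ∈ range ((p - 1) * p ^ r), f ((g : ZMod (p ^ (r + 1))) ^ l).val := by
  have hp : p.Prime := Fact.out
  have : NeZero (p ^ (r + 1)) := ⟨pow_ne_zero _ hp.ne_zero⟩
  have hcop := coprime_of_orderOf hg
  have hmaps : Set.MapsTo (fun l => ((g : ZMod (p ^ (r + 1))) ^ l).val)
      (range ((p - 1) * p ^ r) : Finset ℕ)
      ((range (p ^ (r + 1))).filter (fun a => ¬ p ∣ a) : Finset ℕ) := by
    intro l _
    have hu : IsUnit ((g : ZMod (p ^ (r + 1))) ^ l) := ((ZMod.isUnit_iff_coprime _ _).2 hcop).pow l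
    have h1 : (((g : ZMod (p ^ (r + 1))) ^ l).val).Coprime (p ^ (r + 1)) := by
      rw [← ZMod.isUnit_iff_coprime]
      simpa using hu
    have h2 := Nat.Coprime.coprime_dvd_right (dvd_pow_self p (by omega)) h1
    simp only [coe_filter, mem_range, Set.mem_ofPred_eq]
    exact ⟨ZMod.val_lt _, (Nat.Prime.coprime_iff_not_dvd hp).1 h2.symm⟩
  have hinj : Set.InjOn (fun l => ((g : ZMod (p ^ (r + 1))) ^ l).val)
      (range ((p - 1) * p ^ r) : Finset ℕ) := by
    intro a ha b hb
    exact val_pow_injOn (by rw [hg]; simpa using ha) (by rw [hg]; simpa using hb)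
  have hcard : ((range (p ^ (r + 1))).filter (fun a => ¬ p ∣ a)).card =
      (range ((p - 1) * p ^ r)).card := by
    have h := Nat.totient_eq_card_coprime (p ^ (r + 1))
    rw [Nat.totient_prime_pow hp (by omega)] at h
    rw [card_range, mul_comm, show p ^ r = p ^ (r + 1 - 1) by simp, h]
    congr 1
    ext a
    simp only [mem_filter, mem_range, and_congr_right_iff]
    intro _
    rw [Nat.coprime_pow_left_iff (by omega), Nat.Prime.coprime_iff_not_dvd hp]
  symm
  exact sum_nbij _ (fun a ha => hmaps ha) hinj
    (surjOn_of_injOn_of_card_le _ hmaps hinj hcard.le) (fun _ _ => rfl)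

lemma sum_range_neg_one_pow_of_odd {R : Type*} [CommRing R] {n : ℕ} (hn : Odd n) :
    ∑ y ∈ range n, (-1 : R) ^ y = 1 := by
  rw [neg_one_geom_sum, if_neg (Nat.not_even_iff_odd.2 hn)]

/-- Summing `(-1)^a` over the residues `a` modulo `p ^ (r + 2)` lifting a given power of `g`. -/
lemma neg_one_pow_val_eq_sum {R : Type*} [CommRing R] (hp2 : p ≠ 2) {g r : ℕ}
    (hg : ∀ r, orderOf (g : ZMod (p ^ (r + 1))) = (p - 1) * p ^ r) (k : ℕ) :
    (-1 : R) ^ ((g : ZMod (p ^ (r + 1))) ^ k).val =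
      ∑ i ∈ range p, (-1 : R) ^ ((g : ZMod (p ^ (r + 2))) ^ (k + i * ((p - 1) * p ^ r))).val := by
  have hp : p.Prime := Fact.out
  have hodd := hp.odd_of_ne_two hp2
  have hn1 : NeZero (p ^ (r + 1)) := ⟨pow_ne_zero _ hp.ne_zero⟩
  have hn2 : NeZero (p ^ (r + 2)) := ⟨pow_ne_zero _ hp.ne_zero⟩
  set x : ℕ → ℕ := fun i => ((g : ZMod (p ^ (r + 2))) ^ (k + i * ((p - 1) * p ^ r))).val with hx
  set a := ((g : ZMod (p ^ (r + 1))) ^ k).val with ha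
  have hxlt : ∀ i, x i < p ^ (r + 2) := fun i => ZMod.val_lt _
  have hmod : ∀ i, x i % p ^ (r + 1) = a := by
    intro i
    have h1 : ((x i : ℕ) : ZMod (p ^ (r + 1))) = (g : ZMod (p ^ (r + 1))) ^ k := by
      have h2 : p ^ (r + 1) ∣ p ^ (r + 2) := pow_dvd_pow _ (by omega)
      have h3 : ((x i : ℕ) : ZMod (p ^ (r + 2))) =
        (g : ZMod (p ^ (r + 2))) ^ (k + i * ((p - 1) * p ^ r)) := by simp [hx]
      have h4 := congrArg (ZMod.castHom h2 (ZMod (p ^ (r + 1)))) h3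
      simp only [map_natCast, map_pow] at h4
      rw [h4, pow_add (g : ZMod (p ^ (r + 1))), mul_comm i, pow_mul (g : ZMod (p ^ (r + 1))), ← hg r,
        pow_orderOf_eq_one, one_pow, mul_one]
    rw [← ZMod.val_natCast, h1]
  have hy : ∀ i, x i = a + p ^ (r + 1) * (x i / p ^ (r + 1)) := by
    intro i
    rw [← hmod i]
    exact (Nat.mod_add_div _ _).symm
  have hsgn : ∀ i, (-1 : R) ^ x i = (-1) ^ a * (-1) ^ (x i / p ^ (r + 1)) := by
    intro i
    conv_lhs => rw [hy i, pow_add, pow_mul, (hodd.pow).neg_one_pow]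
  have hinj : Set.InjOn (fun i => x i / p ^ (r + 1)) (range p : Finset ℕ) := by
    intro i hi j hj hij
    have h1 : x i = x j := by
      rw [hy i, hy j]
      simp only at hij
      rw [hij]
    have h2 := ZMod.val_injective _ h1
    have hu : IsUnit (g : ZMod (p ^ (r + 2))) :=
      (ZMod.isUnit_iff_coprime _ _).2 (coprime_of_orderOf (hg (r + 1)))
    rw [pow_add (g : ZMod (p ^ (r + 2))), pow_add (g : ZMod (p ^ (r + 2)))] at h2
    have h3 := (hu.pow k).mul_left_cancel h2
    have hpos : 0 < (p - 1) * p ^ r :=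
      Nat.mul_pos (Nat.sub_pos_of_lt hp.one_lt) (pow_pos hp.pos _)
    have hlt : ∀ i ∈ range p, i * ((p - 1) * p ^ r) < orderOf (g : ZMod (p ^ (r + 2))) := by
      intro i hi
      rw [hg (r + 1), show (p - 1) * p ^ (r + 1) = p * ((p - 1) * p ^ r) by ring]
      exact Nat.mul_lt_mul_of_pos_right (mem_range.1 hi) hpos
    exact Nat.eq_of_mul_eq_mul_right hpos (pow_injOn_Iio_orderOf (hlt i hi) (hlt j hj) h3)
  have hmaps : Set.MapsTo (fun i => x i / p ^ (r + 1)) (range p : Finset ℕ)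
      (range p : Finset ℕ) := by
    intro i _
    simp only [coe_range, Set.mem_Iio]
    rw [Nat.div_lt_iff_lt_mul (pow_pos hp.pos _), ← pow_succ']
    exact hxlt i
  have hsum : ∑ i ∈ range p, (-1 : R) ^ (x i / p ^ (r + 1)) = ∑ y ∈ range p, (-1 : R) ^ y :=
    sum_nbij _ (fun a ha => hmaps ha) hinj
      (surjOn_of_injOn_of_card_le _ hmaps hinj le_rfl) (fun _ _ => rfl)
  rw [sum_congr rfl (fun i _ => hsgn i), ← mul_sum, hsum, sum_range_neg_one_pow_of_odd hodd, mul_one]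

lemma sum_range_mul' {M : Type*} [AddCommMonoid M] (a b : ℕ) (f : ℕ → M) :
    ∑ k ∈ range (a * b), f k = ∑ j ∈ range a, ∑ i ∈ range b, f (j + i * a) := by
  rw [sum_comm]
  induction b with
  | zero => simp
  | succ b ih =>
    rw [Nat.mul_succ, sum_range_add, ih, sum_range_succ]
    simp [add_comm, mul_comm]

/-- The coefficient of the branch of the measure `(-1)^a` on which `g` acts through `η`. -/
def branchCoeff {R : Type*} [CommRing R] (p g : ℕ) (η : R) (r j : ℕ) : R :=
  ∑ i ∈ range (p - 1), (-1) ^ ((g : ZMod (p ^ (r + 1))) ^ (j + i * p ^ r)).val * η ^ (j + i * p ^ r)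

lemma branchCoeff_eq_sum {R : Type*} [CommRing R] (hp2 : p ≠ 2) {g : ℕ}
    (hg : ∀ r, orderOf (g : ZMod (p ^ (r + 1))) = (p - 1) * p ^ r) {η : R} (hη : η ^ (p - 1) = 1)
    (r j : ℕ) :
    branchCoeff p g η r j = ∑ i ∈ range p, branchCoeff p g η (r + 1) (j + i * p ^ r) := by
  set F : ℕ → R := fun k => (-1) ^ ((g : ZMod (p ^ (r + 2))) ^ k).val * η ^ k with hF
  have h1 : ∀ k, (-1) ^ ((g : ZMod (p ^ (r + 1))) ^ k).val * η ^ k =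
      ∑ i ∈ range p, F (k + i * ((p - 1) * p ^ r)) := by
    intro k
    rw [neg_one_pow_val_eq_sum hp2 hg, sum_mul]
    refine sum_congr rfl fun i _ => ?_
    rw [hF]
    simp only
    rw [pow_add η, show i * ((p - 1) * p ^ r) = (p - 1) * (i * p ^ r) by ring, pow_mul η, hη, one_pow,
      mul_one]
  unfold branchCoeff
  simp only [h1]
  have h2 := sum_range_mul' (p - 1) p (fun l => F (j + l * p ^ r))
  have h3 := sum_range_mul' p (p - 1) (fun l => F (j + l * p ^ r))
  rw [mul_comm p] at h3
  rw [h2] at h3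
  calc _ = _ := ?_
    _ = _ := h3
    _ = _ := ?_
  · refine sum_congr rfl fun i _ => sum_congr rfl fun i' _ => ?_
    congr 1
    ring
  · refine sum_congr rfl fun i _ => sum_congr rfl fun i' _ => ?_
    have : j + (i + i' * p) * p ^ r = j + i * p ^ r + i' * p ^ (r + 1) := by ring
    rw [this]

/-- A Teichmüller representative of `g`, as a primitive root of unity. -/
lemma exists_isPrimitiveRoot_padicInt {g : ℕ} (hg : orderOf (g : ZMod p) = p - 1) :
    ∃ ω : ℤ_[p], IsPrimitiveRoot ω (p - 1) ∧ (p : ℤ_[p]) ∣ ω - g := by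
  have hp : p.Prime := Fact.out
  have h1 := hp.one_lt
  have hgne : (g : ZMod p) ≠ 0 := by
    intro h
    have : 0 < orderOf (g : ZMod p) := by omega
    have := (orderOf_pos_iff.1 this).isUnit
    rw [h] at this
    exact not_isUnit_zero this
  have hunit : ‖(g : ℤ_[p])‖ = 1 := by
    by_contra h
    have h2 : ‖((g : ℤ) : ℤ_[p])‖ < 1 := lt_of_le_of_ne (PadicInt.norm_le_one _)
      (by simp at h ⊢; exact h)
    rw [PadicInt.norm_int_lt_one_iff_dvd] at h2
    exact hgne ((ZMod.natCast_eq_zero_iff _ _).2 (Int.natCast_dvd_natCast.1 h2))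
  have hder : ‖((p - 1 : ℕ) : ℤ_[p])‖ = 1 := by
    by_contra h
    have h2 : ‖(((p - 1 : ℕ) : ℤ) : ℤ_[p])‖ < 1 :=
      lt_of_le_of_ne (PadicInt.norm_le_one _) (by simp at h)
    rw [PadicInt.norm_int_lt_one_iff_dvd] at h2
    have := Nat.le_of_dvd (by omega) (Int.natCast_dvd_natCast.1 h2)
    omega
  set F : Polynomial ℤ_[p] := Polynomial.X ^ (p - 1) - 1 with hF
  have hF1 : ∀ a : ℤ_[p], F.aeval a = a ^ (p - 1) - 1 := by intro a; simp [hF]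
  have hF2 : ‖F.derivative.aeval (g : ℤ_[p])‖ = 1 := by
    simp [hF, Polynomial.derivative_X_pow, hunit, hder]
  have hFg : ‖F.aeval (g : ℤ_[p])‖ < 1 := by
    rw [hF1]
    have h2 : ((g : ℤ_[p]) ^ (p - 1) - 1) = (((g : ℤ) ^ (p - 1) - 1 : ℤ) : ℤ_[p]) := by
      push_cast; rfl
    rw [h2, PadicInt.norm_int_lt_one_iff_dvd, ← ZMod.intCast_zmod_eq_zero_iff_dvd]
    push_cast
    rw [ZMod.pow_card_sub_one_eq_one hgne, sub_self]
  obtain ⟨ω, hω, hω2, -⟩ := hensels_lemma (F := F) (a := (g : ℤ_[p])) (by rw [hF2]; simpa using hFg)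
  rw [hF1, sub_eq_zero] at hω
  rw [hF2, PadicInt.norm_lt_one_iff_dvd] at hω2
  refine ⟨ω, ⟨hω, fun l hl => ?_⟩, hω2⟩
  rw [← hg]
  apply orderOf_dvd_of_pow_eq_one
  have h2 : (p : ℤ_[p]) ∣ ω ^ l - (g : ℤ_[p]) ^ l := hω2.trans (sub_dvd_pow_sub_pow _ _ _)
  rw [hl, ← PadicInt.norm_lt_one_iff_dvd,
    show (1 : ℤ_[p]) - (g : ℤ_[p]) ^ l = ((1 - (g : ℤ) ^ l : ℤ) : ℤ_[p]) by push_cast; rfl,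
    PadicInt.norm_int_lt_one_iff_dvd, ← ZMod.intCast_zmod_eq_zero_iff_dvd] at h2
  push_cast at h2
  exact (sub_eq_zero.1 h2).symm
section
open PowerSeries
open scoped Nat

/-- The value at `0` of the `k`-th Euler polynomial. -/
def eulerZero (k : ℕ) : ℚ := 2 * (1 - 2 ^ (k + 1)) * bernoulli (k + 1) / (k + 1)

lemma mk_eulerZero_mul : (PowerSeries.mk fun k => eulerZero k / k !) * (exp ℚ + 1) = 2 := by
  set B := bernoulliPowerSeries ℚ
  have hB : B * (exp ℚ - 1) = X := bernoulliPowerSeries_mul_exp_sub_one ℚ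
  have hB2 : rescale 2 B * (exp ℚ ^ 2 - 1) = 2 * X := by
    have := congrArg (rescale (2 : ℚ)) hB
    rw [map_mul, map_sub, map_one, rescale_X] at this
    rw [exp_pow_eq_rescale_exp]
    simpa [show C (2 : ℚ) = 2 from map_ofNat C 2] using this
  have hX : X * (PowerSeries.mk fun k => eulerZero k / k !) = 2 * B - 2 * rescale 2 B := by
    ext n
    have h2 : (2 : ℚ⟦X⟧) = C 2 := (map_ofNat C 2).symm
    rw [map_sub, h2, coeff_C_mul, coeff_C_mul, coeff_rescale]
    rcases n with _ | n
    · simp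
    · rw [coeff_succ_X_mul]
      simp only [B, bernoulliPowerSeries, coeff_mk, eulerZero, Nat.factorial_succ]
      push_cast
      simp
      field_simp
  have hne : X * (exp ℚ - 1) ≠ 0 := by
    refine mul_ne_zero X_ne_zero ?_
    intro h
    rw [h, mul_zero] at hB
    exact X_ne_zero hB.symm
  apply mul_left_cancel₀ hne
  linear_combination (exp ℚ ^ 2 - 1) * hX + 2 * (exp ℚ + 1) * hB - 2 * hB2

lemma eulerZero_recurrence (k : ℕ) :
    ∑ j ∈ range (k + 1), (k.choose j : ℚ) * eulerZero j + eulerZero k = if k = 0 then 2 else 0 := by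
  have h := congrArg (coeff k) mk_eulerZero_mul
  rw [mul_add, mul_one, map_add, coeff_mul, Nat.sum_antidiagonal_eq_sum_range_succ_mk] at h
  have h2 : (2 : ℚ⟦X⟧) = C 2 := (map_ofNat C 2).symm
  rw [h2, coeff_C] at h
  simp only [coeff_mk, coeff_exp] at h
  have hk : (k ! : ℚ) ≠ 0 := by positivity
  have h3 := congrArg (fun x => (k ! : ℚ) * x) h
  simp only [mul_add, mul_sum] at h3
  have h4 : (k ! : ℚ) * (if k = 0 then 2 else 0) = if k = 0 then 2 else 0 := by
    split_ifs with h
    · simp [h]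
    · simp
  rw [h4] at h3
  rw [← h3]
  congr 1
  · refine sum_congr rfl fun j hj => ?_
    rw [Nat.cast_choose ℚ (Nat.lt_succ_iff.1 (mem_range.1 hj))]
    simp
    field_simp
  · field_simp

lemma eulerZero_ne_zero {k : ℕ} (hk : Odd k) : eulerZero k ≠ 0 := by
  obtain ⟨m, rfl⟩ := hk
  have hB : bernoulli (2 * (m + 1)) ≠ 0 := by
    intro h
    have h1 := riemannZeta_two_mul_nat (k := m + 1) (by omega)
    rw [h] at h1
    refine riemannZeta_ne_zero_of_one_lt_re (s := 2 * ((m + 1 : ℕ) : ℂ)) ?_ (by rw [h1]; simp)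
    have : (2 * ((m + 1 : ℕ) : ℂ)).re = 2 * (m + 1) := by simp
    rw [this]
    have : (0 : ℝ) ≤ m := by positivity
    linarith
  have h2 : (1 - 2 ^ (2 * m + 1 + 1) : ℚ) ≠ 0 := by
    have : (1 : ℚ) < 2 ^ (2 * m + 1 + 1) := one_lt_pow₀ (by norm_num) (by omega)
    linarith
  unfold eulerZero
  have h3 : ((2 * m + 1 : ℕ) : ℚ) + 1 ≠ 0 := by positivity
  rw [show 2 * m + 1 + 1 = 2 * (m + 1) by ring] at *
  exact div_ne_zero (mul_ne_zero (mul_ne_zero two_ne_zero h2) hB) h3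

end

lemma norm_pow_sub_one_le {K : Type*} [NormedField K] [IsUltrametricDist K] {x : K}
    (hx : ‖x‖ = 1) (i : ℕ) : ‖x ^ i - 1‖ ≤ ‖x - 1‖ := by
  rw [← geom_sum_mul, norm_mul]
  refine mul_le_of_le_one_left (norm_nonneg _) ?_
  refine IsUltrametricDist.norm_sum_le_of_forall_le_of_nonneg zero_le_one fun j _ => ?_
  rw [norm_pow, hx, one_pow]

lemma IsPrimitiveRoot.norm_eq_one_of_pos {K : Type*} [NormedField K] {ζ : K} {n : ℕ}
    (h : IsPrimitiveRoot ζ n) (hn : n ≠ 0) : ‖ζ‖ = 1 :=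
  (pow_eq_one_iff_of_nonneg (norm_nonneg _) hn).1 (by rw [← norm_pow, h.pow_eq_one, norm_one])

lemma IsPrimitiveRoot.norm_sub_one_pow_totient {K : Type*} [NormedField K] [IsUltrametricDist K]
    (hpK : ‖(p : K)‖ = (p : ℝ)⁻¹) {r : ℕ} (hr : r ≠ 0) {ζ : K} (hζ : IsPrimitiveRoot ζ (p ^ r)) :
    ‖ζ - 1‖ ^ Nat.totient (p ^ r) = (p : ℝ)⁻¹ := by
  have hp : p.Prime := Fact.out
  obtain ⟨r, rfl⟩ := Nat.exists_eq_succ_of_ne_zero hr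
  have hpr : p ^ (r + 1) ≠ 0 := pow_ne_zero _ hp.ne_zero
  have h1 : ∏ μ ∈ primitiveRoots (p ^ (r + 1)) K, (1 - μ) = p := by
    have h2 := Polynomial.eval_one_cyclotomic_prime_pow (R := K) (p := p) r
    rw [Polynomial.cyclotomic_eq_prod_X_sub_primitiveRoots hζ, Polynomial.eval_prod] at h2
    simpa using h2
  have h3 : ∀ μ ∈ primitiveRoots (p ^ (r + 1)) K, ‖1 - μ‖ = ‖ζ - 1‖ := by
    intro μ hμ
    have hμ' := isPrimitiveRoot_of_mem_primitiveRoots hμ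
    rw [norm_sub_rev]
    obtain ⟨i, -, hi⟩ := hζ.eq_pow_of_pow_eq_one hμ'.pow_eq_one
    obtain ⟨j, -, hj⟩ := hμ'.eq_pow_of_pow_eq_one hζ.pow_eq_one
    apply le_antisymm
    · rw [← hi]; exact norm_pow_sub_one_le (hζ.norm_eq_one_of_pos hpr) i
    · rw [← hj]; exact norm_pow_sub_one_le (hμ'.norm_eq_one_of_pos hpr) j
  have h4 := congrArg norm h1
  rw [norm_prod, prod_congr rfl h3, prod_const, hζ.card_primitiveRoots, hpK] at h4
  exact h4

lemma eq_sum_range_pow_of_compatible {R : Type*} [AddCommMonoid R] {d : ℕ → ℕ → R}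
    (hd : ∀ r, ∀ j < p ^ r, d r j = ∑ i ∈ range p, d (r + 1) (j + i * p ^ r))
    (r n j : ℕ) (hj : j < p ^ r) :
    d r j = ∑ i ∈ range (p ^ n), d (r + n) (j + i * p ^ r) := by
  have hp : p.Prime := Fact.out
  induction n with
  | zero => simp
  | succ n ih =>
    rw [ih, pow_succ, sum_range_mul']
    refine sum_congr rfl fun i hi => ?_
    have hlt : j + i * p ^ r < p ^ (r + n) := by
      have := mem_range.1 hi
      calc j + i * p ^ r < p ^ r + i * p ^ r := by omega
        _ = (i + 1) * p ^ r := by ring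
        _ ≤ p ^ n * p ^ r := Nat.mul_le_mul_right _ this
        _ = p ^ (r + n) := by ring
    rw [hd _ _ hlt]
    refine sum_congr rfl fun i' _ => ?_
    rw [add_assoc r]
    congr 1
    ring

/-- The dominant term of a polynomial `∑ d_j (1 + T)^j` with some unit coefficient. -/
lemma exists_norm_sum_sub_le {q : ℕ} (d : ℕ → ℤ_[p]) (hd : ∃ j < q, ¬ (p : ℤ_[p]) ∣ d j) :
    ∃ lam < q, ∀ (K : Type*) [NormedField K] [IsUltrametricDist K] (φ : ℤ_[p] →+* K),
      (∀ x, ‖φ x‖ = ‖x‖) → ∀ z : K, ‖z - 1‖ < 1 → (p : ℝ)⁻¹ ≤ ‖z - 1‖ ^ (lam + 1) →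
      ∃ u : K, ‖u‖ = 1 ∧
        ‖∑ j ∈ range q, φ (d j) * z ^ j - u * (z - 1) ^ lam‖ ≤ ‖z - 1‖ ^ (lam + 1) := by
  classical
  set f : Polynomial ℤ_[p] := ∑ j ∈ range q, Polynomial.C (d j) * (Polynomial.X + 1) ^ j with hf
  have hfdeg : ∀ n, q ≤ n → f.coeff n = 0 := by
    intro n hn
    rw [hf, Polynomial.finsetSum_coeff]
    refine sum_eq_zero fun j hj => ?_
    rw [Polynomial.coeff_C_mul, Polynomial.coeff_X_add_one_pow,
      Nat.choose_eq_zero_of_lt (by have := mem_range.1 hj; omega)]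
    simp
  have hex : ∃ n, ¬ (p : ℤ_[p]) ∣ f.coeff n := by
    by_contra! h
    obtain ⟨j, hj, hdj⟩ := hd
    have h1 : Polynomial.C (p : ℤ_[p]) ∣ f := Polynomial.C_dvd_iff_dvd_coeff _ _ |>.2 h
    have h2 := map_dvd (Polynomial.compRingHom (Polynomial.X - 1)) h1
    simp only [Polynomial.coe_compRingHom_apply, Polynomial.C_comp] at h2
    have h3 := (Polynomial.C_dvd_iff_dvd_coeff _ _).1 h2 j
    have h4 : f.comp (Polynomial.X - 1) = ∑ j ∈ range q, Polynomial.C (d j) * Polynomial.X ^ j := by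
      rw [hf, Polynomial.sum_comp]
      refine sum_congr rfl fun j _ => ?_
      simp
    rw [h4, Polynomial.finsetSum_coeff] at h3
    simp only [Polynomial.coeff_C_mul_X_pow] at h3
    rw [sum_ite_eq, if_pos (mem_range.2 hj)] at h3
    exact hdj h3
  have hlamq : Nat.find hex < q := by
    by_contra! h
    exact Nat.find_spec hex (by rw [hfdeg _ h]; exact dvd_zero _)
  refine ⟨Nat.find hex, hlamq, ?_⟩
  set lam := Nat.find hex
  intro K _ _ φ hφ z hz hpz
  have hunit : ‖f.coeff lam‖ = 1 := by
    refine le_antisymm (PadicInt.norm_le_one _) (not_lt.1 fun h => ?_)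
    exact Nat.find_spec hex ((PadicInt.norm_lt_one_iff_dvd _).1 h)
  refine ⟨φ (f.coeff lam), by rw [hφ, hunit], ?_⟩
  have hsum : ∑ j ∈ range q, φ (d j) * z ^ j = ∑ n ∈ range q, φ (f.coeff n) * (z - 1) ^ n := by
    have hq : 0 < q := by omega
    have hnat : f.natDegree < q := by
      have : f.natDegree ≤ q - 1 :=
        Polynomial.natDegree_le_iff_coeff_eq_zero.2 fun n hn => hfdeg n (by omega)
      omega
    rw [← Polynomial.eval₂_eq_sum_range' φ hnat, hf, Polynomial.eval₂_finsetSum]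
    refine sum_congr rfl fun j _ => ?_
    simp [Polynomial.eval₂_mul, Polynomial.eval₂_pow, Polynomial.eval₂_add]
  rw [hsum, ← add_sum_erase _ _ (mem_range.2 hlamq), add_sub_cancel_left]
  refine IsUltrametricDist.norm_sum_le_of_forall_le_of_nonneg (by positivity) fun n hn => ?_
  obtain ⟨hne, -⟩ := mem_erase.1 hn
  rw [norm_mul, hφ, norm_pow]
  rcases lt_or_gt_of_ne hne with h | h
  · have h1 : (p : ℤ_[p]) ∣ f.coeff n := not_not.1 (Nat.find_min hex h)
    obtain ⟨b, hb⟩ := h1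
    have h2 : ‖f.coeff n‖ ≤ (p : ℝ)⁻¹ := by
      rw [hb, norm_mul, PadicInt.norm_p]
      exact mul_le_of_le_one_right (by positivity) (PadicInt.norm_le_one _)
    calc _ ≤ (p : ℝ)⁻¹ * 1 :=
          mul_le_mul h2 (pow_le_one₀ (norm_nonneg _) hz.le) (by positivity) (by positivity)
      _ ≤ _ := by rwa [mul_one]
  · calc _ ≤ 1 * ‖z - 1‖ ^ (lam + 1) :=
          mul_le_mul (PadicInt.norm_le_one _)
            (pow_le_pow_of_le_one (norm_nonneg _) hz.le h) (by positivity) zero_le_one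
      _ = _ := one_mul _

lemma exists_norm_sum_eq_pow_of_not_dvd {K : Type*} [NormedField K] [IsUltrametricDist K]
    (φ : ℤ_[p] →+* K) (hφ : ∀ x, ‖φ x‖ = ‖x‖) {d : ℕ → ℕ → ℤ_[p]}
    (hd : ∀ r, ∀ j < p ^ r, d r j = ∑ i ∈ range p, d (r + 1) (j + i * p ^ r))
    (hne : ∃ r, ∃ j < p ^ r, ¬ (p : ℤ_[p]) ∣ d r j) :
    ∃ lam r₀ : ℕ, ∀ r > r₀, ∀ ζ : K, IsPrimitiveRoot ζ (p ^ r) →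
      ‖∑ j ∈ range (p ^ r), φ (d r j) * ζ ^ j‖ = ‖ζ - 1‖ ^ lam := by
  have hp : p.Prime := Fact.out
  have hpR : (0 : ℝ) < p := by exact_mod_cast hp.pos
  have hpK : ‖(p : K)‖ = (p : ℝ)⁻¹ := by
    rw [← map_natCast φ, hφ, PadicInt.norm_p]
  obtain ⟨r₀, hr₀⟩ := hne
  obtain ⟨lam, hlam, hmain⟩ := exists_norm_sum_sub_le (d r₀) hr₀
  refine ⟨lam, r₀, fun r hr ζ hζ => ?_⟩
  obtain ⟨n, rfl⟩ := Nat.exists_eq_add_of_lt hr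
  rw [show r₀ + n + 1 = r₀ + (n + 1) by ring] at hζ ⊢
  set q := p ^ r₀ with hq
  have hqpos : 0 < q := pow_pos hp.pos _
  have hnorm := hζ.norm_eq_one_of_pos (pow_ne_zero _ hp.ne_zero)
  have hπ := IsPrimitiveRoot.norm_sub_one_pow_totient hpK (by omega) hζ
  have hζq : IsPrimitiveRoot (ζ ^ q) (p ^ (n + 1)) :=
    hζ.pow (pow_pos hp.pos _) (by rw [hq, pow_add])
  have hπq := IsPrimitiveRoot.norm_sub_one_pow_totient hpK (by omega) hζq
  have htot : Nat.totient (p ^ (r₀ + (n + 1))) = q * Nat.totient (p ^ (n + 1)) := by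
    rw [Nat.totient_prime_pow hp (by omega), Nat.totient_prime_pow hp (by omega), hq]
    rw [show r₀ + (n + 1) - 1 = r₀ + n by omega, show n + 1 - 1 = n by omega]
    ring
  have htpos : 0 < Nat.totient (p ^ (n + 1)) := Nat.totient_pos.2 (pow_pos hp.pos _)
  have hωq : ‖ζ ^ q - 1‖ = ‖ζ - 1‖ ^ q := by
    rw [htot, pow_mul, ← hπq] at hπ
    exact ((pow_left_inj₀ (by positivity) (norm_nonneg _) htpos.ne').1 hπ).symm
  have hlt : ‖ζ - 1‖ < 1 := by
    by_contra! h
    have h1 := one_le_pow₀ h (n := Nat.totient (p ^ (r₀ + (n + 1))))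
    rw [hπ] at h1
    exact (inv_lt_one_of_one_lt₀ (by exact_mod_cast hp.one_lt : (1 : ℝ) < p)).not_ge h1
  have hpos : 0 < ‖ζ - 1‖ := by
    refine lt_of_le_of_ne (norm_nonneg _) fun h => ?_
    rw [← h, zero_pow (by rw [htot]; positivity)] at hπ
    exact (inv_pos.2 hpR).ne hπ
  have hple : (p : ℝ)⁻¹ ≤ ‖ζ - 1‖ ^ (lam + 1) := by
    rw [← hπ]
    refine pow_le_pow_of_le_one (norm_nonneg _) hlt.le ?_
    rw [htot]
    exact hlam.trans_le (Nat.le_mul_of_pos_right _ htpos)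
  obtain ⟨u, hu, hle⟩ := hmain K φ hφ ζ hlt hple
  have hdiff : ‖∑ j ∈ range (p ^ (r₀ + (n + 1))), φ (d (r₀ + (n + 1)) j) * ζ ^ j -
      ∑ j ∈ range q, φ (d r₀ j) * ζ ^ j‖ ≤ ‖ζ - 1‖ ^ (lam + 1) := by
    rw [pow_add p, ← hq, sum_range_mul', ← sum_sub_distrib]
    refine IsUltrametricDist.norm_sum_le_of_forall_le_of_nonneg (by positivity) fun j hj => ?_
    rw [eq_sum_range_pow_of_compatible hd r₀ (n + 1) j (mem_range.1 hj), map_sum, sum_mul,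
      ← sum_sub_distrib]
    refine IsUltrametricDist.norm_sum_le_of_forall_le_of_nonneg (by positivity) fun i _ => ?_
    rw [← mul_sub, norm_mul, hφ, pow_add, mul_comm i, pow_mul,
      show ζ ^ j * (ζ ^ q) ^ i - ζ ^ j = ζ ^ j * ((ζ ^ q) ^ i - 1) by ring, norm_mul, norm_pow, hnorm,
      one_pow, one_mul]
    calc _ ≤ 1 * ‖ζ - 1‖ ^ (lam + 1) := by
          refine mul_le_mul (PadicInt.norm_le_one _) ?_ (norm_nonneg _) zero_le_one
          refine (norm_pow_sub_one_le (by rw [norm_pow, hnorm, one_pow]) i).trans ?_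
          rw [hωq]
          exact pow_le_pow_of_le_one (norm_nonneg _) hlt.le hlam
      _ = _ := one_mul _
  have hfin : ‖∑ j ∈ range (p ^ (r₀ + (n + 1))), φ (d (r₀ + (n + 1)) j) * ζ ^ j -
      u * (ζ - 1) ^ lam‖ < ‖u * (ζ - 1) ^ lam‖ := by
    rw [norm_mul, norm_pow, hu, one_mul]
    refine lt_of_le_of_lt ?_ (pow_lt_pow_right_of_lt_one₀ hpos hlt (Nat.lt_succ_self lam))
    have := (IsUltrametricDist.norm_add_le_max
      (∑ j ∈ range (p ^ (r₀ + (n + 1))), φ (d (r₀ + (n + 1)) j) * ζ ^ j -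
      ∑ j ∈ range q, φ (d r₀ j) * ζ ^ j) (∑ j ∈ range q, φ (d r₀ j) * ζ ^ j - u * (ζ - 1) ^ lam)).trans
      (max_le hdiff hle)
    rwa [sub_add_sub_cancel] at this
  rw [IsUltrametricDist.norm_eq_of_add_norm_lt_max (x := ∑ j ∈ range (p ^ (r₀ + (n + 1))),
    φ (d (r₀ + (n + 1)) j) * ζ ^ j) (y := -(u * (ζ - 1) ^ lam)) (by
      rw [← sub_eq_add_neg, norm_neg]
      exact lt_of_lt_of_le hfin (le_max_right _ _))]
  rw [norm_neg, norm_mul, norm_pow, hu, one_mul]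

/-- Norms of the values at `ζ - 1` of a nonzero measure on `ℤ_p`, for `ζ` of large `p`-power order. -/
lemma exists_norm_sum_eq_inv_pow_mul_pow {K : Type*} [NormedField K] [IsUltrametricDist K]
    (φ : ℤ_[p] →+* K) (hφ : ∀ x, ‖φ x‖ = ‖x‖) {c : ℕ → ℕ → ℤ_[p]}
    (hc : ∀ r j, c r j = ∑ i ∈ range p, c (r + 1) (j + i * p ^ r))
    (hne : ∃ r, ∃ j < p ^ r, c r j ≠ 0) :
    ∃ e lam r₀ : ℕ, ∀ r > r₀, ∀ ζ : K, IsPrimitiveRoot ζ (p ^ r) →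
      ‖∑ j ∈ range (p ^ r), φ (c r j) * ζ ^ j‖ = (p : ℝ)⁻¹ ^ e * ‖ζ - 1‖ ^ lam := by
  classical
  have hp : p.Prime := Fact.out
  have hp0 : (p : ℤ_[p]) ≠ 0 := by exact_mod_cast hp.ne_zero
  have hex : ∃ e, ∃ r, ∃ j < p ^ r, ¬ (p : ℤ_[p]) ^ (e + 1) ∣ c r j := by
    obtain ⟨r, j, hj, h⟩ := hne
    obtain ⟨e, he⟩ := FiniteMultiplicity.of_prime_left PadicInt.prime_p h
    exact ⟨e, r, j, hj, he⟩
  set e := Nat.find hex with he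
  have hall : ∀ r, ∀ j, ∃ x, j < p ^ r → c r j = (p : ℤ_[p]) ^ e * x := by
    intro r j
    by_cases hj : j < p ^ r
    · have : (p : ℤ_[p]) ^ e ∣ c r j := by
        rcases Nat.eq_zero_or_pos e with h | h
        · rw [h]; simp
        · have := Nat.find_min hex (m := e - 1) (by omega)
          push Not at this
          have := this r j hj
          rwa [show e - 1 + 1 = e by omega] at this
      obtain ⟨x, hx⟩ := this
      exact ⟨x, fun _ => hx⟩
    · exact ⟨0, fun h => absurd h hj⟩
  choose d hd using hall
  obtain ⟨lam, r₀, h⟩ := exists_norm_sum_eq_pow_of_not_dvd φ hφ (d := d) (by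
    intro r j hj
    apply mul_left_cancel₀ (pow_ne_zero e hp0)
    rw [← hd r j hj, hc, mul_sum]
    refine sum_congr rfl fun i hi => hd _ _ ?_
    calc j + i * p ^ r < p ^ r + i * p ^ r := by omega
        _ = (i + 1) * p ^ r := by ring
        _ ≤ p * p ^ r := Nat.mul_le_mul_right _ (mem_range.1 hi)
        _ = p ^ (r + 1) := by ring) (by
    obtain ⟨r, j, hj, h⟩ := Nat.find_spec hex
    refine ⟨r, j, hj, fun h2 => h ?_⟩
    rw [hd r j hj, pow_succ]
    exact mul_dvd_mul_left _ h2)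
  refine ⟨e, lam, r₀, fun r hr ζ hζ => ?_⟩
  rw [← h r hr ζ hζ, sum_congr rfl fun j hj => by rw [hd r j (mem_range.1 hj)]]
  simp only [map_mul, mul_assoc]
  rw [← mul_sum, norm_mul, hφ, norm_pow, PadicInt.norm_p]

lemma norm_sub_le_max' {E : Type*} [SeminormedAddCommGroup E] [IsUltrametricDist E] (x y : E) :
    ‖x - y‖ ≤ max ‖x‖ ‖y‖ := by
  simpa [sub_eq_add_neg] using IsUltrametricDist.norm_add_le_max x (-y)

/-- The alternating power sum `∑_{a < n} (-1)^a a^k`. -/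
def altPowerSum (k n : ℕ) : ℤ := ∑ a ∈ range n, (-1) ^ a * (a : ℤ) ^ k

lemma altPowerSum_recurrence {n : ℕ} (hn : Odd n) (k : ℕ) :
    ∑ j ∈ range (k + 1), (k.choose j : ℤ) * altPowerSum j n + altPowerSum k n =
      (n : ℤ) ^ k + if k = 0 then 1 else 0 := by
  have h1 : ∑ j ∈ range (k + 1), (k.choose j : ℤ) * altPowerSum j n =
      ∑ a ∈ range n, (-1) ^ a * ((a : ℤ) + 1) ^ k := by
    simp only [altPowerSum, mul_sum]
    rw [sum_comm]
    refine sum_congr rfl fun a _ => ?_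
    rw [add_pow, mul_sum]
    refine sum_congr rfl fun j _ => ?_
    simp
    ring
  have h2 : ∀ m : ℕ, ∑ a ∈ range m, (-1) ^ a * ((a : ℤ) + 1) ^ k + altPowerSum k m =
      0 ^ k - (-1) ^ m * (m : ℤ) ^ k := by
    intro m
    induction m with
    | zero => simp [altPowerSum]
    | succ m ih =>
      simp only [altPowerSum, sum_range_succ] at ih ⊢
      push_cast
      rw [pow_succ]
      linear_combination ih
  rw [h1, h2, hn.neg_one_pow]
  rcases Nat.eq_zero_or_pos k with rfl | hk
  · simp
  · simp [hk.ne']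

lemma norm_altPowerSum_sub_eulerZero_le (hp2 : p ≠ 2) (r k : ℕ) :
    ‖((altPowerSum k (p ^ r) : ℚ_[p]) - (eulerZero k : ℚ_[p]))‖ ≤ ((p : ℝ) ^ r)⁻¹ := by
  have hp : p.Prime := Fact.out
  have hodd := hp.odd_of_ne_two hp2
  have h2 : ‖(2 : ℚ_[p])‖ = 1 := by
    have : ‖((2 : ℤ) : ℚ_[p])‖ = 1 := by
      refine le_antisymm (Padic.norm_int_le_one _) (not_lt.1 fun h => ?_)
      rw [Padic.norm_intCast_lt_one_iff] at h
      exact hp2 ((Nat.prime_dvd_prime_iff_eq hp Nat.prime_two).1 (Int.natCast_dvd_natCast.1 h))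
    simpa using this
  induction k using Nat.strong_induction_on with
  | _ k ih =>
  have e1 := congrArg (fun x : ℤ => (x : ℚ_[p])) (altPowerSum_recurrence (hodd.pow (n := r)) k)
  have e2 := congrArg (fun x : ℚ => (x : ℚ_[p])) (eulerZero_recurrence k)
  simp only [sum_range_succ, Nat.choose_self] at e1 e2
  push_cast at e1 e2
  set d : ℕ → ℚ_[p] := fun k => (altPowerSum k (p ^ r) : ℚ_[p]) - (eulerZero k : ℚ_[p]) with hd
  have e3 : 2 * d k = (if k = 0 then 0 else ((p : ℚ_[p]) ^ r) ^ k) -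
      ∑ j ∈ range k, (k.choose j : ℚ_[p]) * d j := by
    simp only [hd, mul_sub, sum_sub_distrib]
    split_ifs at e1 e2 ⊢ with hk
    · subst hk
      simp at e1 e2 ⊢
      linear_combination e1 - e2
    · linear_combination e1 - e2
  have e4 : ‖2 * d k‖ ≤ ((p : ℝ) ^ r)⁻¹ := by
    rw [e3]
    refine (norm_sub_le_max' _ _).trans (max_le ?_ ?_)
    · split_ifs with hk
      · simp
      · rw [norm_pow, norm_pow, Padic.norm_p, inv_pow]
        refine pow_le_of_le_one (by positivity) (inv_le_one_of_one_le₀ ?_) hk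
        exact one_le_pow₀ (by exact_mod_cast hp.one_lt.le)
    · refine IsUltrametricDist.norm_sum_le_of_forall_le_of_nonneg (by positivity) fun j hj => ?_
      rw [norm_mul]
      calc _ ≤ 1 * ((p : ℝ) ^ r)⁻¹ := by
            refine mul_le_mul ?_ (ih j (mem_range.1 hj)) (norm_nonneg _) zero_le_one
            simpa using Padic.norm_int_le_one (p := p) (k.choose j : ℤ)
        _ = _ := one_mul _
  rwa [norm_mul, h2, one_mul] at e4

lemma sum_filter_not_dvd_neg_one_pow_mul_pow (hp2 : p ≠ 2) (r k : ℕ) :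
    ∑ a ∈ (range (p ^ (r + 1))).filter (fun a => ¬ p ∣ a), (-1) ^ a * (a : ℤ) ^ k =
      altPowerSum k (p ^ (r + 1)) - (p : ℤ) ^ k * altPowerSum k (p ^ r) := by
  have hp : p.Prime := Fact.out
  rw [eq_sub_iff_add_eq, altPowerSum, altPowerSum,
    ← sum_filter_not_add_sum_filter (range (p ^ (r + 1))) (fun a => p ∣ a)]
  congr 1
  rw [mul_sum]
  refine sum_nbij (fun b => p * b) ?_ ?_ ?_ ?_
  · intro b hb
    simp only [mem_filter, mem_range] at hb ⊢
    exact ⟨by rw [pow_succ']; exact Nat.mul_lt_mul_of_pos_left hb hp.pos, dvd_mul_right _ _⟩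
  · intro a _ b _ h
    exact Nat.eq_of_mul_eq_mul_left hp.pos h
  · rintro a ha
    simp only [coe_filter, mem_range, Set.mem_ofPred_eq] at ha
    obtain ⟨ha, b, rfl⟩ := ha
    refine ⟨b, ?_, rfl⟩
    rw [pow_succ'] at ha
    simpa using Nat.lt_of_mul_lt_mul_left ha
  · intro b _
    rw [pow_mul, (hp.odd_of_ne_two hp2).neg_one_pow]
    push_cast
    ring

/-- For `η` congruent to an odd power of `g`, the branch of the measure `(-1)^a` is nonzero. -/
lemma exists_branchCoeff_ne_zero (hp2 : p ≠ 2) {g : ℕ}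
    (hg : ∀ r, orderOf (g : ZMod (p ^ (r + 1))) = (p - 1) * p ^ r) {η : ℤ_[p]}
    (hη : η ^ (p - 1) = 1) {k : ℕ} (hk : Odd k) (hηg : (p : ℤ_[p]) ∣ η - (g : ℤ_[p]) ^ k) :
    ∃ r, ∃ j < p ^ r, branchCoeff p g η r j ≠ 0 := by
  have hp : p.Prime := Fact.out
  have h1p := hp.one_lt
  by_contra! hzero
  have hinv : η * η ^ (p - 2) = 1 := by
    rw [← pow_succ', show p - 2 + 1 = p - 1 by omega, hη]
  set u : ℤ_[p] := (g : ℤ_[p]) ^ k * η ^ (p - 2) with hu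
  have hgu : (g : ℤ_[p]) ^ k = η * u := by
    rw [hu]; linear_combination -(g : ℤ_[p]) ^ k * hinv
  have hu1 : (p : ℤ_[p]) ∣ u - 1 := by
    have : u - 1 = (η - (g : ℤ_[p]) ^ k) * (-η ^ (p - 2)) := by rw [hu]; linear_combination hinv
    rw [this]
    exact hηg.mul_right _
  have hdvd : ∀ r, ((p : ℤ_[p]) ^ (r + 1)) ∣
      ((altPowerSum k (p ^ (r + 1)) - (p : ℤ) ^ k * altPowerSum k (p ^ r) : ℤ) : ℤ_[p]) := by
    intro r
    have : NeZero (p ^ (r + 1)) := ⟨pow_ne_zero _ hp.ne_zero⟩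
    rw [← sum_filter_not_dvd_neg_one_pow_mul_pow hp2]
    push_cast
    rw [sum_filter_not_dvd_eq_sum_val_pow (hg r), mul_comm (p - 1), sum_range_mul']
    set q := (p : ℤ_[p]) ^ (r + 1) with hq
    have huq : ∀ i, q ∣ u ^ (i * p ^ r) - 1 := by
      intro i
      have h1 := dvd_sub_pow_of_dvd_sub (R := ℤ_[p]) hu1 r
      rw [one_pow] at h1
      have h2 := sub_dvd_pow_sub_pow (u ^ p ^ r) 1 i
      rw [one_pow, ← pow_mul, mul_comm (p ^ r)] at h2
      exact h1.trans h2
    have hval : ∀ l, q ∣ (((g : ZMod (p ^ (r + 1))) ^ l).val : ℤ_[p]) - (g : ℤ_[p]) ^ l := by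
      intro l
      have h1 : ((p ^ (r + 1) : ℕ) : ℤ) ∣ (((g : ZMod (p ^ (r + 1))) ^ l).val : ℤ) - (g : ℤ) ^ l := by
        rw [← ZMod.intCast_zmod_eq_zero_iff_dvd]
        simp
      have h2 := map_dvd (Int.castRingHom ℤ_[p]) h1
      simpa [hq] using h2
    have key : ∀ j, q ∣ ∑ i ∈ range (p - 1), (-1) ^ ((g : ZMod (p ^ (r + 1))) ^ (j + i * p ^ r)).val *
        (((g : ZMod (p ^ (r + 1))) ^ (j + i * p ^ r)).val : ℤ_[p]) ^ k -
        branchCoeff p g η r j * u ^ j := by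
      intro j
      rw [branchCoeff, sum_mul, ← sum_sub_distrib]
      refine dvd_sum fun i _ => ?_
      set l := j + i * p ^ r with hl
      set v := ((g : ZMod (p ^ (r + 1))) ^ l).val
      have e1 : q ∣ (v : ℤ_[p]) ^ k - ((g : ℤ_[p]) ^ l) ^ k := (hval l).trans (sub_dvd_pow_sub_pow _ _ _)
      have e2 : ((g : ℤ_[p]) ^ l) ^ k = η ^ l * u ^ j * u ^ (i * p ^ r) := by
        rw [← pow_mul, mul_comm l, pow_mul, hgu, mul_pow, hl, pow_add u]
        ring
      have e3 : (-1) ^ v * (v : ℤ_[p]) ^ k - (-1) ^ v * η ^ l * u ^ j =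
          (-1) ^ v * ((v : ℤ_[p]) ^ k - ((g : ℤ_[p]) ^ l) ^ k) +
            (-1) ^ v * η ^ l * u ^ j * (u ^ (i * p ^ r) - 1) := by
        rw [e2]; ring
      rw [e3]
      exact dvd_add (e1.mul_left _) ((huq i).mul_left _)
    refine dvd_sum fun j hj => ?_
    have := key j
    rwa [hzero r j (mem_range.1 hj), zero_mul, sub_zero] at this
  have hlim : ∀ r : ℕ, ‖(eulerZero k : ℚ_[p]) * (1 - (p : ℚ_[p]) ^ k)‖ ≤ ((p : ℝ) ^ r)⁻¹ := by
    intro r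
    have hpr : ((p : ℝ) ^ (r + 1))⁻¹ ≤ ((p : ℝ) ^ r)⁻¹ := by
      have : (1 : ℝ) ≤ p := by exact_mod_cast h1p.le
      gcongr
      omega
    obtain ⟨c, hc⟩ := hdvd r
    have h0 := congrArg (fun x : ℤ_[p] => (x : ℚ_[p])) hc
    have h1 : ‖((altPowerSum k (p ^ (r + 1)) : ℚ_[p]) - (p : ℚ_[p]) ^ k * altPowerSum k (p ^ r))‖ ≤
        ((p : ℝ) ^ r)⁻¹ := by
      push_cast at h0
      rw [h0, norm_mul, norm_pow, Padic.norm_p, inv_pow]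
      calc _ ≤ ((p : ℝ) ^ (r + 1))⁻¹ * 1 := by
            gcongr
            exact c.2
        _ ≤ _ := by rw [mul_one]; exact hpr
    have h2 := (norm_altPowerSum_sub_eulerZero_le hp2 (r + 1) k).trans hpr
    have h3 := norm_altPowerSum_sub_eulerZero_le hp2 r k
    have h4 : (eulerZero k : ℚ_[p]) * (1 - (p : ℚ_[p]) ^ k) =
        ((altPowerSum k (p ^ (r + 1)) : ℚ_[p]) - (p : ℚ_[p]) ^ k * altPowerSum k (p ^ r)) -
        (((altPowerSum k (p ^ (r + 1)) : ℚ_[p]) - (eulerZero k : ℚ_[p])) -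
          (p : ℚ_[p]) ^ k * ((altPowerSum k (p ^ r) : ℚ_[p]) - (eulerZero k : ℚ_[p]))) := by ring
    rw [h4]
    refine (norm_sub_le_max' _ _).trans (max_le h1 ((norm_sub_le_max' _ _).trans (max_le h2 ?_)))
    rw [norm_mul]
    refine (mul_le_of_le_one_left (norm_nonneg _) ?_).trans h3
    rw [norm_pow]
    exact pow_le_one₀ (norm_nonneg _) (Padic.norm_p_lt_one).le
  have hz : ‖(eulerZero k : ℚ_[p]) * (1 - (p : ℚ_[p]) ^ k)‖ = 0 := by
    refine le_antisymm ?_ (norm_nonneg _)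
    have ht : Filter.Tendsto (fun r : ℕ => ((p : ℝ) ^ r)⁻¹) Filter.atTop (nhds 0) :=
      (tendsto_pow_atTop_atTop_of_one_lt (by exact_mod_cast h1p)).inv_tendsto_atTop
    exact ge_of_tendsto' ht hlim
  rw [norm_eq_zero, mul_eq_zero] at hz
  rcases hz with hz | hz
  · exact eulerZero_ne_zero hk (by exact_mod_cast hz)
  · have h1 : ((p ^ k : ℕ) : ℚ_[p]) = (1 : ℕ) := by push_cast; exact (sub_eq_zero.1 hz).symm
    have h2 : p ^ k = 1 := by exact_mod_cast h1
    exact (Nat.one_lt_pow hk.pos.ne' h1p).ne' h2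

lemma exists_unit_generator {g r : ℕ}
    (hg : orderOf (g : ZMod (p ^ (r + 1))) = (p - 1) * p ^ r) :
    ∃ u : (ZMod (p ^ (r + 1)))ˣ, (u : ZMod (p ^ (r + 1))) = g ∧ ∀ x, x ∈ Subgroup.zpowers u := by
  have hp : p.Prime := Fact.out
  have : NeZero (p ^ (r + 1)) := ⟨pow_ne_zero _ hp.ne_zero⟩
  refine ⟨ZMod.unitOfCoprime g (coprime_of_orderOf hg), by simp, fun x => ?_⟩
  have h1 : Nat.card (Subgroup.zpowers (ZMod.unitOfCoprime g (coprime_of_orderOf hg))) =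
      Nat.card (ZMod (p ^ (r + 1)))ˣ := by
    rw [Nat.card_zpowers, ← orderOf_units, ZMod.coe_unitOfCoprime, hg, Nat.card_eq_fintype_card,
      ZMod.card_units_eq_totient, Nat.totient_prime_pow hp (by omega), mul_comm]
    simp
  rw [Subgroup.eq_top_of_card_eq _ h1]
  trivial

lemma exists_eq_pow_of_isUnit {g r : ℕ}
    (hg : orderOf (g : ZMod (p ^ (r + 1))) = (p - 1) * p ^ r) (x : (ZMod (p ^ (r + 1)))ˣ) :
    ∃ l : ℕ, (x : ZMod (p ^ (r + 1))) = (g : ZMod (p ^ (r + 1))) ^ l := by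
  have hp : p.Prime := Fact.out
  have : NeZero (p ^ (r + 1)) := ⟨pow_ne_zero _ hp.ne_zero⟩
  obtain ⟨u, hu, hgen⟩ := exists_unit_generator hg
  have h1 := hgen x
  rw [← mem_powers_iff_mem_zpowers] at h1
  obtain ⟨l, hl⟩ := h1
  exact ⟨l, by rw [← hl, ← hu]; simp⟩

lemma pow_half_eq_neg_one (hp2 : p ≠ 2) {g r : ℕ}
    (hg : orderOf (g : ZMod (p ^ (r + 1))) = (p - 1) * p ^ r) :
    (g : ZMod (p ^ (r + 1))) ^ ((p - 1) / 2 * p ^ r) = -1 := by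
  have hp : p.Prime := Fact.out
  obtain ⟨h, hh⟩ := (hp.odd_of_ne_two hp2)
  have hh' : p - 1 = 2 * h := by omega
  obtain ⟨l, hl⟩ := exists_eq_pow_of_isUnit hg (-1)
  rw [Units.val_neg, Units.val_one] at hl
  have hd : (p - 1) * p ^ r ∣ 2 * l := by
    rw [← hg]
    apply orderOf_dvd_of_pow_eq_one
    rw [mul_comm, pow_mul, ← hl]
    simp
  rw [hh', Nat.mul_div_cancel_left _ two_pos]
  rw [hh', mul_assoc] at hd
  obtain ⟨m, rfl⟩ := Nat.dvd_of_mul_dvd_mul_left two_pos hd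
  have h1 : (g : ZMod (p ^ (r + 1))) ^ (2 * (h * p ^ r)) = 1 := by
    rw [← mul_assoc, ← hh', ← hg, pow_orderOf_eq_one]
  rcases Nat.even_or_odd m with hm | hm
  · obtain ⟨m, rfl⟩ := hm.two_dvd
    rw [← mul_assoc, mul_comm _ 2, pow_mul, h1, one_pow] at hl
    have : Fact (2 < p ^ (r + 1)) := ⟨by
      have h3 : 2 < p := lt_of_le_of_ne hp.two_le hp2.symm
      exact h3.trans_le (Nat.le_self_pow (by omega) p)⟩
    exact absurd hl ZMod.neg_one_ne_one
  · obtain ⟨m, rfl⟩ := hm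
    rw [show h * p ^ r * (2 * m + 1) = 2 * (h * p ^ r) * m + h * p ^ r by ring,
      pow_add (g : ZMod (p ^ (r + 1))), pow_mul (g : ZMod (p ^ (r + 1))), h1, one_pow,
      one_mul] at hl
    exact hl.symm

variable {K : Type*} [Field K]

lemma DirichletCharacter.ext_of_apply_generator {g r : ℕ}
    (hg : orderOf (g : ZMod (p ^ (r + 1))) = (p - 1) * p ^ r)
    {χ ψ : DirichletCharacter K (p ^ (r + 1))} (h : χ g = ψ g) : χ = ψ := by
  apply MulChar.ext
  intro x
  obtain ⟨l, hl⟩ := exists_eq_pow_of_isUnit hg x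
  rw [hl, map_pow, map_pow, h]

lemma DirichletCharacter.exists_apply_generator_eq {g r : ℕ}
    (hg : orderOf (g : ZMod (p ^ (r + 1))) = (p - 1) * p ^ r)
    {ξ : K} (hξ : ξ ^ ((p - 1) * p ^ r) = 1) :
    ∃ χ : DirichletCharacter K (p ^ (r + 1)), χ g = ξ := by
  have hp : p.Prime := Fact.out
  have : NeZero (p ^ (r + 1)) := ⟨pow_ne_zero _ hp.ne_zero⟩
  obtain ⟨u, hu, hgen⟩ := exists_unit_generator hg
  have hpos : (p - 1) * p ^ r ≠ 0 :=
    (Nat.mul_pos (Nat.sub_pos_of_lt hp.one_lt) (pow_pos hp.pos _)).ne'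
  set ξ' : Kˣ := Units.ofPowEqOne ξ _ hξ hpos
  have hmem : ξ' ∈ rootsOfUnity (Fintype.card (ZMod (p ^ (r + 1)))ˣ) K := by
    rw [ZMod.card_units_eq_totient, Nat.totient_prime_pow hp (by omega), Nat.add_sub_cancel, mul_comm]
    exact Units.pow_ofPowEqOne hξ hpos
  refine ⟨MulChar.ofRootOfUnity hmem hgen, ?_⟩
  rw [← hu, MulChar.ofRootOfUnity_spec]
  rfl

lemma DirichletCharacter.isPrimitive_iff_apply_generator {g s : ℕ}
    (hg : ∀ r, orderOf (g : ZMod (p ^ (r + 1))) = (p - 1) * p ^ r)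
    (χ : DirichletCharacter K (p ^ (s + 2))) :
    χ.IsPrimitive ↔ χ g ^ ((p - 1) * p ^ s) ≠ 1 := by
  have hp : p.Prime := Fact.out
  have : NeZero (p ^ (s + 2)) := ⟨pow_ne_zero _ hp.ne_zero⟩
  have hdvd : p ^ (s + 1) ∣ p ^ (s + 2) := pow_dvd_pow _ (by omega)
  have h1 : χ.IsPrimitive ↔ ¬ χ.FactorsThrough (p ^ (s + 1)) := by
    constructor
    · intro h hf
      have h2 : χ.conductor ≤ p ^ (s + 1) := Nat.sInf_le hf
      rw [(χ.isPrimitive_def).1 h] at h2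
      exact (Nat.pow_lt_pow_right hp.one_lt (by omega : s + 1 < s + 2)).not_ge h2
    · intro h
      obtain ⟨k, hk, hk2⟩ := (Nat.dvd_prime_pow hp).1 χ.conductor_dvd_level
      rw [isPrimitive_def, hk2]
      by_contra hne
      have hk3 : k ≤ s + 1 := by
        by_contra h3
        exact hne (by rw [show k = s + 2 by omega])
      exact h (FactorsThrough.mono χ χ.factorsThrough_conductor
        (by rw [hk2]; exact pow_dvd_pow _ hk3) hdvd)
  rw [h1, not_iff_not, factorsThrough_iff_ker_unitsMap hdvd]
  have hcast : ∀ l, ZMod.castHom hdvd (ZMod (p ^ (s + 1))) ((g : ZMod (p ^ (s + 2))) ^ l) =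
      (g : ZMod (p ^ (s + 1))) ^ l := by
    intro l; rw [map_pow, map_natCast]
  constructor
  · intro h
    obtain ⟨u, hu, -⟩ := exists_unit_generator (hg (s + 1))
    have h2 : u ^ ((p - 1) * p ^ s) ∈ (ZMod.unitsMap hdvd).ker := by
      rw [MonoidHom.mem_ker]
      ext
      rw [ZMod.unitsMap_def, Units.coe_map]
      simp only [Units.val_pow_eq_pow_val, hu, Units.val_one]
      have := hcast ((p - 1) * p ^ s)
      rw [← hg s, pow_orderOf_eq_one, hg s] at this
      exact this
    have h3 := h h2
    rw [MonoidHom.mem_ker] at h3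
    have h4 := congrArg (fun x : Kˣ => (x : K)) h3
    simpa [hu] using h4
  · intro h x hx
    rw [MonoidHom.mem_ker] at hx ⊢
    obtain ⟨l, hl⟩ := exists_eq_pow_of_isUnit (hg (s + 1)) x
    have h2 := congrArg (fun x : (ZMod (p ^ (s + 1)))ˣ => (x : ZMod (p ^ (s + 1)))) hx
    simp only [ZMod.unitsMap_def, Units.coe_map, Units.val_one] at h2
    have h3 : (g : ZMod (p ^ (s + 1))) ^ l = 1 := by
      rw [← hcast l]
      exact (congrArg _ hl.symm).trans h2
    have h4 := orderOf_dvd_of_pow_eq_one h3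
    rw [hg s] at h4
    obtain ⟨m, rfl⟩ := h4
    ext
    rw [MulChar.coe_toUnitHom, hl, map_pow, pow_mul, h, one_pow, Units.val_one]

lemma DirichletCharacter.odd_iff_apply_generator (hp2 : p ≠ 2) {g r : ℕ}
    (hg : orderOf (g : ZMod (p ^ (r + 1))) = (p - 1) * p ^ r)
    (χ : DirichletCharacter K (p ^ (r + 1))) : χ.Odd ↔ χ g ^ ((p - 1) / 2 * p ^ r) = -1 := by
  rw [DirichletCharacter.Odd, ← pow_half_eq_neg_one hp2 hg, map_pow]

lemma pow_prime_pow_eq_self {M : Type*} [Monoid M] {x : M} (hx : x ^ (p - 1) = 1) (r : ℕ) :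
    x ^ p ^ r = x := by
  have hp : p.Prime := Fact.out
  induction r with
  | zero => simp
  | succ r ih =>
    rw [pow_succ, pow_mul, ih]
    conv_lhs => rw [show p = p - 1 + 1 by have := hp.one_lt; omega, pow_succ, hx, one_mul]

lemma IsPrimitiveRoot.pow_half_eq_neg_one_of_odd (hp2 : p ≠ 2) {ω : K}
    (hω : IsPrimitiveRoot ω (p - 1)) : ω ^ ((p - 1) / 2) = -1 := by
  have hp : p.Prime := Fact.out
  obtain ⟨h, hh⟩ := (hp.odd_of_ne_two hp2)
  have h1 := hp.one_lt
  have h2 : (p - 1) / 2 * 2 = p - 1 := by omega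
  have h3 : (ω ^ ((p - 1) / 2)) ^ 2 = 1 := by rw [← pow_mul, h2, hω.pow_eq_one]
  rcases mul_self_eq_one_iff.1 ((sq _).symm.trans h3) with h4 | h4
  · exact absurd h4 (hω.pow_ne_one_of_pos_of_lt (by omega) (by omega))
  · exact h4

lemma DirichletCharacter.bijOn_apply_generator [CharZero K] [DecidableEq K] (hp2 : p ≠ 2) {g s : ℕ}
    (hg : ∀ r, orderOf (g : ZMod (p ^ (r + 1))) = (p - 1) * p ^ r) {ω : K}
    (hω : IsPrimitiveRoot ω (p - 1)) :
    Set.BijOn (fun χ : DirichletCharacter K (p ^ (s + 2)) => χ g)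
      {χ | χ.IsPrimitive ∧ χ.Odd}
      (((range (p - 1)).filter _root_.Odd ×ˢ primitiveRoots (p ^ (s + 1)) K).image
        (fun x : ℕ × K => ω ^ x.1 * x.2) : Finset K) := by
  have hp : p.Prime := Fact.out
  have h1p := hp.one_lt
  have hneg : (-1 : K) ≠ 1 := by
    intro h
    have : (2 : K) = 0 := by linear_combination -h
    exact two_ne_zero this
  have hhalf := hω.pow_half_eq_neg_one_of_odd hp2
  have hppos : 0 < p ^ (s + 1) := pow_pos hp.pos _
  refine ⟨fun χ hχ => ?_, fun χ _ ψ _ h => DirichletCharacter.ext_of_apply_generator (hg (s + 1)) h,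
    fun ξ hξ => ?_⟩
  · rw [Set.mem_ofPred_eq, isPrimitive_iff_apply_generator hg,
      odd_iff_apply_generator hp2 (hg (s + 1))] at hχ
    obtain ⟨hprim, hodd⟩ := hχ
    have hξ1 : χ g ^ ((p - 1) * p ^ (s + 1)) = 1 := by
      rw [← map_pow, ← hg, pow_orderOf_eq_one, map_one]
    set ξ := χ g
    set η := ξ ^ p ^ (s + 1) with hη
    have hη1 : η ^ (p - 1) = 1 := by rw [hη, ← pow_mul, mul_comm, hξ1]
    have : NeZero (p - 1) := ⟨by omega⟩
    obtain ⟨k, hk, hkη⟩ := hω.eq_pow_of_pow_eq_one hη1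
    have hinv : η * η ^ (p - 2) = 1 := by
      rw [← pow_succ', show p - 2 + 1 = p - 1 by omega, hη1]
    have hkodd : _root_.Odd k := by
      rw [mul_comm, pow_mul, ← hη, ← hkη, ← pow_mul, mul_comm, pow_mul, hhalf] at hodd
      by_contra h
      rw [(Nat.not_odd_iff_even.1 h).neg_one_pow] at hodd
      exact hneg hodd.symm
    have hξeq : ω ^ k * (ξ * η ^ (p - 2)) = ξ := by
      rw [hkη]; linear_combination ξ * hinv
    have hζ : IsPrimitiveRoot (ξ * η ^ (p - 2)) (p ^ (s + 1)) := by
      rw [IsPrimitiveRoot.iff_orderOf]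
      apply orderOf_eq_prime_pow
      · intro h
        apply hprim
        rw [← hξeq, mul_pow, hkη, mul_comm (p - 1), pow_mul (ξ * η ^ (p - 2)), h, one_pow,
          mul_comm _ (p - 1), pow_mul, hη1, one_pow, one_mul]
      · rw [mul_pow, ← hη, ← pow_mul, mul_comm (p - 2), pow_mul, pow_prime_pow_eq_self hη1, hinv]
    rw [coe_image]
    refine ⟨(k, ξ * η ^ (p - 2)), ?_, hξeq⟩
    simp only [coe_product, Set.mem_prod, mem_coe, mem_filter, mem_range]
    exact ⟨⟨hk, hkodd⟩, (mem_primitiveRoots hppos).2 hζ⟩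
  · rw [coe_image] at hξ
    obtain ⟨⟨k, ζ⟩, hmem, rfl⟩ := hξ
    simp only [coe_product, Set.mem_prod, mem_coe, mem_filter, mem_range,
      mem_primitiveRoots hppos] at hmem
    obtain ⟨⟨hk, hkodd⟩, hζ⟩ := hmem
    have hωk : (ω ^ k) ^ (p - 1) = 1 := by rw [← pow_mul, mul_comm, pow_mul, hω.pow_eq_one, one_pow]
    obtain ⟨χ, hχ⟩ := exists_apply_generator_eq (hg (s + 1)) (ξ := ω ^ k * ζ) (by
      rw [mul_pow, pow_mul (ω ^ k), hωk, one_pow, mul_comm (p - 1), pow_mul, hζ.pow_eq_one, one_pow,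
        one_mul])
    refine ⟨χ, ?_, hχ⟩
    rw [Set.mem_ofPred_eq, isPrimitive_iff_apply_generator hg,
      odd_iff_apply_generator hp2 (hg (s + 1)), hχ]
    constructor
    · rw [mul_pow, pow_mul (ω ^ k), hωk, one_pow, one_mul]
      intro h
      have h2 := hζ.dvd_of_pow_eq_one _ h
      rw [pow_succ', Nat.mul_dvd_mul_iff_right (pow_pos hp.pos _)] at h2
      have := Nat.le_of_dvd (by omega) h2
      omega
    · rw [mul_pow, mul_comm ((p - 1) / 2), pow_mul ζ, hζ.pow_eq_one, one_pow, mul_one, ← pow_mul,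
        mul_comm (p ^ (s + 1)), ← mul_assoc, mul_comm k, mul_assoc, pow_mul, hhalf]
      exact (hkodd.mul (hp.odd_of_ne_two hp2).pow).neg_one_pow

lemma injOn_pow_mul_primitiveRoots {s : ℕ} {ω : K} (hω : IsPrimitiveRoot ω (p - 1)) :
    Set.InjOn (fun x : ℕ × K => ω ^ x.1 * x.2)
      ((range (p - 1)).filter Odd ×ˢ primitiveRoots (p ^ s) K : Finset (ℕ × K)) := by
  have hp : p.Prime := Fact.out
  rintro ⟨k, ζ⟩ h ⟨k', ζ'⟩ h' heq
  simp only [coe_product, Set.mem_prod, mem_coe, mem_filter, mem_range,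
      mem_primitiveRoots (pow_pos hp.pos s)] at h h' heq
  have hωk : ∀ k, (ω ^ k) ^ (p - 1) = 1 := fun k => by
    rw [← pow_mul, mul_comm, pow_mul, hω.pow_eq_one, one_pow]
  have h1 := congrArg (fun x => x ^ p ^ s) heq
  simp only [mul_pow, h.2.pow_eq_one, h'.2.pow_eq_one, mul_one, pow_prime_pow_eq_self (hωk _)] at h1
  have h2 := hω.pow_inj h.1.1 h'.1.1 h1
  subst h2
  have hne : ω ^ k ≠ 0 := by
    intro h0
    have := hωk k
    rw [h0, zero_pow (by have := hp.one_lt; omega)] at this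
    exact zero_ne_one this
  rw [mul_left_cancel₀ hne heq]

lemma DirichletCharacter.sum_neg_one_pow_mul_eq {g r : ℕ}
    (hg : orderOf (g : ZMod (p ^ (r + 1))) = (p - 1) * p ^ r)
    (χ : DirichletCharacter K (p ^ (r + 1))) :
    ∑ a ∈ Icc 1 (p ^ (r + 1)), (-1 : K) ^ a * χ ((a : ℕ) : ZMod (p ^ (r + 1))) =
      ∑ l ∈ range ((p - 1) * p ^ r), (-1) ^ ((g : ZMod (p ^ (r + 1))) ^ l).val * χ g ^ l := by
  have hp : p.Prime := Fact.out
  have : NeZero (p ^ (r + 1)) := ⟨pow_ne_zero _ hp.ne_zero⟩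
  have h1 := sum_filter_not_dvd_eq_sum_val_pow hg
    (fun a => (-1 : K) ^ a * χ ((a : ℕ) : ZMod (p ^ (r + 1))))
  simp only [ZMod.natCast_val, ZMod.cast_id', id_eq, map_pow] at h1
  rw [← h1]
  symm
  apply sum_subset
  · intro a ha
    simp only [mem_filter, mem_range, mem_Icc] at ha ⊢
    refine ⟨Nat.pos_of_ne_zero fun h => ha.2 (by rw [h]; exact dvd_zero _), ha.1.le⟩
  · intro a ha hna
    have hpa : p ∣ a := by
      by_contra h
      simp only [mem_filter, mem_range, mem_Icc, not_and, not_not] at ha hna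
      rcases ha.2.lt_or_eq with h2 | h2
      · exact h (hna h2)
      · exact h (by rw [h2]; exact dvd_pow_self _ (by omega))
    rw [χ.map_nonunit, mul_zero]
    rw [ZMod.isUnit_iff_coprime, Nat.coprime_pow_right_iff (by omega), Nat.coprime_comm,
      Nat.Prime.coprime_iff_not_dvd hp]
    exact fun h => h hpa

end

lemma sum_neg_one_pow_mul_pow_eq_sum_branchCoeff {R S : Type*} [CommRing R] [CommRing S]
    (φ : R →+* S) (p g r : ℕ) (η : R) {ζ : S} (hζ : ζ ^ p ^ r = 1) :
    ∑ l ∈ range ((p - 1) * p ^ r), (-1) ^ ((g : ZMod (p ^ (r + 1))) ^ l).val * (φ η * ζ) ^ l =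
      ∑ j ∈ range (p ^ r), φ (branchCoeff p g η r j) * ζ ^ j := by
  rw [mul_comm (p - 1), sum_range_mul']
  refine sum_congr rfl fun j _ => ?_
  rw [branchCoeff, map_sum, sum_mul]
  refine sum_congr rfl fun i _ => ?_
  have h : ζ ^ (j + i * p ^ r) = ζ ^ j := by
    rw [pow_add, mul_comm i, pow_mul ζ, hζ, one_pow, mul_one]
  rw [mul_pow, h, map_mul, map_pow, map_pow, map_neg, map_one, mul_assoc]

section
variable {p : ℕ} [Fact p.Prime]

lemma prod_primitiveRoots_norm_sub_one {K : Type*} [NontriviallyNormedField K] [IsAlgClosed K]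
    [CharZero K] [IsUltrametricDist K] (hpK : ‖(p : K)‖ = (p : ℝ)⁻¹) {r : ℕ} (hr : r ≠ 0) :
    ∏ ζ ∈ primitiveRoots (p ^ r) K, ‖ζ - 1‖ = (p : ℝ)⁻¹ := by
  have hp : p.Prime := Fact.out
  have : NeZero (p ^ r) := ⟨pow_ne_zero _ hp.ne_zero⟩
  have : NeZero ((p ^ r : ℕ) : K) := ⟨Nat.cast_ne_zero.2 (pow_ne_zero _ hp.ne_zero)⟩
  obtain ⟨ζ₀, hζ₀⟩ := HasEnoughRootsOfUnity.exists_primitiveRoot K (p ^ r)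
  have h1 := hζ₀.norm_sub_one_pow_totient hpK hr
  rw [prod_congr rfl (g := fun _ => ‖ζ₀ - 1‖), prod_const, hζ₀.card_primitiveRoots, h1]
  intro ζ hζ
  have h2 := (isPrimitiveRoot_of_mem_primitiveRoots hζ).norm_sub_one_pow_totient hpK hr
  exact (pow_left_inj₀ (norm_nonneg _) (norm_nonneg _)
    (Nat.totient_pos.2 (pow_pos hp.pos r)).ne').1 (h2.trans h1.symm)

/-- The product of the numbers `E_{0,χ}` over the odd primitive characters modulo `n`. -/
noncomputable def eulerNumberProd (K : Type*) [Field K] (n : ℕ) : K :=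
  ∏ᶠ (χ : DirichletCharacter K n) (_ : χ.IsPrimitive ∧ χ.Odd),
    ∑ a ∈ Icc 1 n, (-1 : K) ^ a * χ ((a : ℕ) : ZMod n)

lemma exists_norm_eulerNumberProd_eq (hp2 : p ≠ 2) (K : Type*) [NontriviallyNormedField K]
    [IsAlgClosed K] [IsUltrametricDist K] [Algebra ℚ_[p] K]
    (hnorm : ∀ x : ℚ_[p], ‖algebraMap ℚ_[p] K x‖ = ‖x‖) :
    ∃ e lam s₀ : ℕ, ∀ s ≥ s₀,
      ‖eulerNumberProd K (p ^ (s + 2))‖ = (p : ℝ)⁻¹ ^ (e * (p ^ s * (p - 1)) + lam) := by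
  classical
  have hp : p.Prime := Fact.out
  have : CharZero K := charZero_of_injective_algebraMap (algebraMap ℚ_[p] K).injective
  have hpK : ‖(p : K)‖ = (p : ℝ)⁻¹ := by
    rw [← map_natCast (algebraMap ℚ_[p] K), hnorm, Padic.norm_p]
  set φ : ℤ_[p] →+* K := (algebraMap ℚ_[p] K).comp PadicInt.Coe.ringHom
  have hφ : ∀ x, ‖φ x‖ = ‖x‖ := fun x => hnorm x
  have hφinj : Function.Injective φ :=
    (algebraMap ℚ_[p] K).injective.comp Subtype.coe_injective
  obtain ⟨g, hg⟩ := exists_orderOf_natCast_zmod_prime_pow hp2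
  have hg0 := hg 0
  rw [pow_zero, mul_one, zero_add, pow_one] at hg0
  obtain ⟨ω, hω, hωg⟩ := exists_isPrimitiveRoot_padicInt hg0
  have hφω := hω.map_of_injective hφinj
  have hbranch : ∀ k : ℕ, ∃ e lam r₀ : ℕ, Odd k → ∀ r > r₀, ∀ ζ : K, IsPrimitiveRoot ζ (p ^ r) →
      ‖∑ j ∈ range (p ^ r), φ (branchCoeff p g (ω ^ k) r j) * ζ ^ j‖ =
        (p : ℝ)⁻¹ ^ e * ‖ζ - 1‖ ^ lam := by
    intro k
    by_cases hk : Odd k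
    · have hη : (ω ^ k) ^ (p - 1) = 1 := by
        rw [← pow_mul, mul_comm, pow_mul, hω.pow_eq_one, one_pow]
      obtain ⟨e, lam, r₀, h⟩ := exists_norm_sum_eq_inv_pow_mul_pow φ hφ
        (branchCoeff_eq_sum hp2 hg hη)
        (exists_branchCoeff_ne_zero hp2 hg hη hk (hωg.trans (sub_dvd_pow_sub_pow _ _ _)))
      exact ⟨e, lam, r₀, fun _ => h⟩
    · exact ⟨0, 0, 0, fun h => absurd h hk⟩
  choose e lam r₀ hE using hbranch
  set I := (range (p - 1)).filter Odd
  refine ⟨∑ k ∈ I, e k, ∑ k ∈ I, lam k, I.sup r₀, fun s hs => ?_⟩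
  have hprod : eulerNumberProd K (p ^ (s + 2)) = ∏ k ∈ I, ∏ ζ ∈ primitiveRoots (p ^ (s + 1)) K,
      ∑ j ∈ range (p ^ (s + 1)), φ (branchCoeff p g (ω ^ k) (s + 1) j) * ζ ^ j := by
    have h1 := finprod_mem_eq_of_bijOn
      (f := fun χ : DirichletCharacter K (p ^ (s + 2)) =>
        ∑ a ∈ Icc 1 (p ^ (s + 2)), (-1 : K) ^ a * χ ((a : ℕ) : ZMod (p ^ (s + 2))))
      (g := fun ξ : K => ∑ l ∈ range ((p - 1) * p ^ (s + 1)),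
        (-1) ^ ((g : ZMod (p ^ (s + 1 + 1))) ^ l).val * ξ ^ l) _
      (DirichletCharacter.bijOn_apply_generator (s := s) hp2 hg hφω)
      (fun χ _ => DirichletCharacter.sum_neg_one_pow_mul_eq (hg (s + 1)) χ)
    rw [finprod_mem_coe_finset, prod_image (injOn_pow_mul_primitiveRoots hφω), prod_product] at h1
    refine h1.trans (prod_congr rfl fun k _ => prod_congr rfl fun ζ hζ => ?_)
    simp only [← map_pow φ]
    exact sum_neg_one_pow_mul_pow_eq_sum_branchCoeff φ p g (s + 1) (ω ^ k)
      (isPrimitiveRoot_of_mem_primitiveRoots hζ).pow_eq_one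
  have : NeZero (p ^ (s + 1)) := ⟨pow_ne_zero _ hp.ne_zero⟩
  have : NeZero ((p ^ (s + 1) : ℕ) : K) := ⟨Nat.cast_ne_zero.2 (pow_ne_zero _ hp.ne_zero)⟩
  obtain ⟨ζ₀, hζ₀⟩ := HasEnoughRootsOfUnity.exists_primitiveRoot K (p ^ (s + 1))
  have hcard : #(primitiveRoots (p ^ (s + 1)) K) = p ^ s * (p - 1) := by
    rw [hζ₀.card_primitiveRoots, Nat.totient_prime_pow hp s.succ_pos, Nat.succ_sub_one]
  rw [hprod, norm_prod, sum_mul, ← sum_add_distrib, ← prod_pow_eq_pow_sum]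
  refine prod_congr rfl fun k hk => ?_
  have hr : r₀ k < s + 1 := Nat.lt_succ_of_le ((le_sup hk).trans hs)
  rw [norm_prod, prod_congr rfl fun ζ hζ => hE k (mem_filter.1 hk).2 _ hr ζ
    (isPrimitiveRoot_of_mem_primitiveRoots hζ), prod_mul_distrib, prod_const, hcard, prod_pow,
    prod_primitiveRoots_norm_sub_one hpK s.succ_ne_zero, ← pow_mul, ← pow_add]

end

/-- Let `p` be an odd prime and work in `ℂ_p`, modelled as a
complete, algebraically closed, nonarchimedean normed field `K` whose norm
extends the `p`-adic norm of `ℚ_p`; write `ord_p x = −log‖x‖/log p`. Then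
there exist `m ∈ ℚ`, `λ ∈ ℕ`, `c ∈ ℚ` and `n₀ ∈ ℕ` such that for all `n ≥ n₀`,
`ord_p (∏_{t=n₀}^n ∏_χ E_{0,χ}) = m·p^n + λ·n + c`, where the inner product
runs over all odd primitive Dirichlet characters `χ` of conductor `p^t` with
values in `K`, and `E_{0,χ} = ∑_{a=1}^{p^t} (−1)^a χ(a)`. -/
theorem statement15 (p : ℕ) [Fact p.Prime] (hp2 : p ≠ 2)
    (K : Type*) [NontriviallyNormedField K] [IsAlgClosed K] [CompleteSpace K]
    [IsUltrametricDist K] [Algebra ℚ_[p] K]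
    (hnorm : ∀ x : ℚ_[p], ‖algebraMap ℚ_[p] K x‖ = ‖x‖) :
    ∃ (m : ℚ) (lam : ℕ) (C : ℚ) (n₀ : ℕ), ∀ n : ℕ, n₀ ≤ n →
      -Real.log ‖∏ t ∈ Finset.Icc n₀ n,
          ∏ᶠ (χ : DirichletCharacter K (p ^ t)) (_ : χ.IsPrimitive ∧ χ.Odd),
            ∑ a ∈ Finset.Icc 1 (p ^ t), (-1 : K) ^ a * χ ((a : ℕ) : ZMod (p ^ t))‖ /
          Real.log p =
        (m : ℝ) * (p : ℝ) ^ n + (lam : ℝ) * n + (C : ℝ) := by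
  have hp : p.Prime := Fact.out
  have hp0 : (p : ℝ) ≠ 0 := Nat.cast_ne_zero.2 hp.ne_zero
  have hlog : Real.log p ≠ 0 := (Real.log_pos (by exact_mod_cast hp.one_lt)).ne'
  obtain ⟨e, lam, s₀, h⟩ := exists_norm_eulerNumberProd_eq hp2 K hnorm
  have hne : ∀ s ≥ s₀, ‖eulerNumberProd K (p ^ (s + 2))‖ ≠ 0 := fun s hs => by
    rw [h s hs]
    exact pow_ne_zero _ (inv_ne_zero hp0)
  have hlogs : ∀ s ≥ s₀, Real.log ‖eulerNumberProd K (p ^ (s + 2))‖ =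
      -(e * (p ^ s * (p - 1)) + lam) * Real.log p := fun s hs => by
    rw [h s hs, Real.log_pow, Real.log_inv]
    push_cast [Nat.cast_sub hp.one_le]
    ring
  refine ⟨e / p, lam, -e * p ^ s₀ - lam * (s₀ + 1), s₀ + 2, fun n hn => ?_⟩
  change -Real.log ‖∏ t ∈ Icc (s₀ + 2) n, eulerNumberProd K (p ^ t)‖ / Real.log p = _
  rw [norm_prod, div_eq_iff hlog]
  induction n, hn using Nat.le_induction with
  | base =>
    rw [Icc_self, prod_singleton, hlogs s₀ le_rfl]
    push_cast
    field_simp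
    ring
  | succ n hn ih =>
    obtain ⟨s, rfl⟩ : ∃ s, n = s + 1 := ⟨n - 1, by omega⟩
    rw [prod_Icc_succ_top (by omega), Real.log_mul _ (hne s (by omega)), neg_add, ih,
      hlogs s (by omega)]
    · push_cast
      field_simp
      ring
    · refine prod_ne_zero_iff.2 fun t ht => ?_
      obtain ⟨s, rfl⟩ : ∃ s, t = s + 2 := ⟨t - 2, by rw [mem_Icc] at ht; omega⟩
      exact hne s (by rw [mem_Icc] at ht; omega)
end
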